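/- Let n = m + k. For an n×n unitary matrix g, let π(g) ⊆ ℂⁿ denote the subspace spanned by the last k columns of g; π(g) is a k-dimensional subspace. Let Gr(k, ℂⁿ) denote the set of all k-dimensional subspaces of ℂⁿ, and let ι : Gr(k, ℂⁿ) → U(n) be any map satisfying π(ι(W)) = W for all W ∈ Gr(k, ℂⁿ). Then for every g ∈ U(n) there exists a unique block diagonal unitary matrix h = A ⊕ B, with A an m×m unitary matrix and B a k×k unitary matrix, such that g = ι(π(g)) · h. -/

import Mathlib

open Matrix

/-- `colSpanLast g` is the subspace of `ℂⁿ` (`n = m + k`) spanned by the last `k`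
columns of `g`, i.e. the columns `g · e_j` for `j` in the second summand. -/
noncomputable def colSpanLast {m k : ℕ} (g : Matrix (Fin m ⊕ Fin k) (Fin m ⊕ Fin k) ℂ) :
    Submodule ℂ (Fin m ⊕ Fin k → ℂ) :=
  Submodule.span ℂ (Set.range fun j : Fin k => fun i => g i (Sum.inr j))

theorem finrank_colSpanLast {m k : ℕ} {g : Matrix (Fin m ⊕ Fin k) (Fin m ⊕ Fin k) ℂ}
    (hg : gᴴ * g = 1) : Module.finrank ℂ (colSpanLast g) = k := by
  have hcol : LinearIndependent ℂ g.col :=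
    Matrix.linearIndependent_cols_of_isUnit (IsUnit.of_mul_eq_one_right _ hg)
  exact (finrank_span_eq_card (hcol.comp Sum.inr Sum.inr_injective)).trans (Fintype.card_fin k)

/-- The first `m` columns of a unitary matrix are orthogonal to the span of the last `k`. -/
theorem conjTranspose_mulVec_inl_eq_zero {m k : ℕ}
    {u : Matrix (Fin m ⊕ Fin k) (Fin m ⊕ Fin k) ℂ} (hu : uᴴ * u = 1)
    {x : Fin m ⊕ Fin k → ℂ} (hx : x ∈ colSpanLast u) (i : Fin m) :
    (uᴴ *ᵥ x) (Sum.inl i) = 0 := by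
  induction hx using Submodule.span_induction with
  | mem x hx =>
    obtain ⟨j, rfl⟩ := hx
    have h : (uᴴ * u) (Sum.inl i) (Sum.inr j) = 0 := by simp [hu]
    exact h
  | zero => simp
  | add x y _ _ hx hy => simp [Matrix.mulVec_add, hx, hy]
  | smul a x _ hx => simp [Matrix.mulVec_smul, hx]

/-- A unitary matrix whose upper right block vanishes is block diagonal with unitary blocks. -/
theorem exists_eq_fromBlocks_of_toBlocks₁₂_eq_zero {m k : ℕ}
    {h : Matrix (Fin m ⊕ Fin k) (Fin m ⊕ Fin k) ℂ} (hh : hᴴ * h = 1) (h₁₂ : h.toBlocks₁₂ = 0) :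
    ∃ (A : Matrix (Fin m) (Fin m) ℂ) (B : Matrix (Fin k) (Fin k) ℂ),
      Aᴴ * A = 1 ∧ Bᴴ * B = 1 ∧ h = Matrix.fromBlocks A 0 0 B := by
  have hblocks := h.fromBlocks_toBlocks
  rw [h₁₂] at hblocks
  rw [← hblocks, Matrix.fromBlocks_conjTranspose, Matrix.fromBlocks_multiply,
    ← Matrix.fromBlocks_one, Matrix.fromBlocks_inj] at hh
  obtain ⟨hA, -, hC, hB⟩ := hh
  simp only [Matrix.conjTranspose_zero, Matrix.zero_mul, Matrix.mul_zero, zero_add] at hC hB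
  have hC₀ : h.toBlocks₂₁ = 0 := by
    rw [← Matrix.one_mul h.toBlocks₂₁, ← mul_eq_one_comm.mp hB, Matrix.mul_assoc, hC,
      Matrix.mul_zero]
  rw [hC₀, Matrix.mul_zero, add_zero] at hA
  exact ⟨_, _, hA, hB, by rw [← hC₀, hblocks]⟩

/-- Given any section `ι` of `π : U(n) → Gr(k, ℂⁿ)`, `π(g) = ` span of the last `k`
columns of `g`, every unitary `g` is uniquely `g = ι(π(g)) · h` with `h = A ⊕ B`
block diagonal unitary.  In particular `π(g)` is `k`-dimensional. -/
theorem stmt14 {m k : ℕ}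
    (ι : {W : Submodule ℂ (Fin m ⊕ Fin k → ℂ) // Module.finrank ℂ W = k} →
      Matrix (Fin m ⊕ Fin k) (Fin m ⊕ Fin k) ℂ)
    (hι : ∀ W, (ι W)ᴴ * ι W = 1 ∧ colSpanLast (ι W) = W.1)
    (g : Matrix (Fin m ⊕ Fin k) (Fin m ⊕ Fin k) ℂ) (hg : gᴴ * g = 1) :
    ∃ hdim : Module.finrank ℂ (colSpanLast g) = k,
      ∃! h : Matrix (Fin m ⊕ Fin k) (Fin m ⊕ Fin k) ℂ,
        (∃ (A : Matrix (Fin m) (Fin m) ℂ) (B : Matrix (Fin k) (Fin k) ℂ),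
          Aᴴ * A = 1 ∧ Bᴴ * B = 1 ∧ h = Matrix.fromBlocks A 0 0 B) ∧
        g = ι ⟨colSpanLast g, hdim⟩ * h := by
  have hdim := finrank_colSpanLast hg
  obtain ⟨hu, hspan⟩ := hι ⟨colSpanLast g, hdim⟩
  refine ⟨hdim, ?_⟩
  set u := ι ⟨colSpanLast g, hdim⟩
  have hu' : u * uᴴ = 1 := mul_eq_one_comm.mp hu
  refine ⟨uᴴ * g, ⟨exists_eq_fromBlocks_of_toBlocks₁₂_eq_zero ?_ ?_, ?_⟩, ?_⟩
  · rw [Matrix.conjTranspose_mul, Matrix.conjTranspose_conjTranspose, Matrix.mul_assoc,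
      ← Matrix.mul_assoc u, hu', Matrix.one_mul, hg]
  · ext i j
    have hj : (fun l => g l (Sum.inr j)) ∈ colSpanLast u :=
      hspan ▸ Submodule.subset_span ⟨j, rfl⟩
    exact conjTranspose_mulVec_inl_eq_zero hu hj i
  · rw [← Matrix.mul_assoc, hu', Matrix.one_mul]
  · rintro h ⟨-, hgh⟩
    rw [hgh, ← Matrix.mul_assoc, hu, Matrix.one_mul]
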